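/- (Delayer effect, external source.) For every neuronal circuit NC, neuron N, natural number m, and input list inp : List (ℕ → Bool), if is_initial_Cir(NC), N is a member of ListNeuro(NC), length(ListNeuro(NC)) ≤ m < len(NC), One_input(N, m, len(NC)), and τ_N ≤ w_N(m), then output_NC(N, inp) = (map (fun f => f m) inp) ++ [false]. -/

import Mathlib

structure NeuronFeature where
  Id : ℕ
  Weights : ℕ → ℚ
  Leak_Factor : ℚ
  Tau : ℚ
  LeakRange : 0 ≤ Leak_Factor ∧ Leak_Factor ≤ 1
  PosTau : 0 < Tau
  WRange : ∀ x, -1 ≤ Weights x ∧ Weights x ≤ 1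
  WId : Weights Id = 0

structure Neuron where
  Output : List Bool
  CurPot : ℚ
  Feature : NeuronFeature
  CurPot_Output : decide (Feature.Tau ≤ CurPot) = Output.headD false

def potential (ws : ℕ → ℚ) (inp : ℕ → Bool) : ℕ → ℚ
  | 0 => 0
  | m + 1 => if inp m then potential ws inp m + ws m else potential ws inp m

def NextPotential (N : Neuron) (inp : ℕ → Bool) (len : ℕ) : ℚ :=
  if N.Feature.Tau ≤ N.CurPot then potential N.Feature.Weights inp len
  else potential N.Feature.Weights inp len + N.Feature.Leak_Factor * N.CurPot

def NextNeuron (inp : ℕ → Bool) (len : ℕ) (N : Neuron) : Neuron :=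
  ⟨decide (N.Feature.Tau ≤ NextPotential N inp len) :: N.Output,
   NextPotential N inp len, N.Feature, rfl⟩

def AfterNstepsNeuron (N : Neuron) (inp : List (ℕ → Bool)) (len : ℕ) : Neuron :=
  match inp with
  | [] => N
  | i :: tl => NextNeuron i len (AfterNstepsNeuron N tl len)

def SetNeuron (nf : NeuronFeature) : Neuron :=
  ⟨[false], 0, nf, by simp [not_le.mpr nf.PosTau]⟩

def EquivFeature (nf1 nf2 : NeuronFeature) (len : ℕ) : Prop :=
  nf1.Id = nf2.Id ∧ (∀ id, id < len → nf1.Weights id = nf2.Weights id) ∧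
    nf1.Leak_Factor = nf2.Leak_Factor ∧ nf1.Tau = nf2.Tau

def EquivNeuron (n1 n2 : Neuron) (len : ℕ) : Prop :=
  EquivFeature n1.Feature n2.Feature len ∧ n1.Output = n2.Output ∧ n1.CurPot = n2.CurPot

def is_initial_neuro (n : Neuron) (len : ℕ) : Prop :=
  ∃ nf : NeuronFeature, EquivNeuron n (SetNeuron nf) len

def One_Input_Or_Less (nf : NeuronFeature) (id len : ℕ) : Prop :=
  id < len ∧ ∀ id', id ≠ id' → id' < len → nf.Weights id' = 0

def inpSI (inp : List Bool) : List (ℕ → Bool) :=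
  inp.map (fun b _ => b)

structure NeuroCircuit where
  Time : ℕ
  ListNeuro : List Neuron
  SupplInput : ℕ
  IdNeuroDiff : ListNeuro.Pairwise (fun a b => a.Feature.Id ≠ b.Feature.Id)
  IdInfLen : ∀ n ∈ ListNeuro, n.Feature.Id < ListNeuro.length
  TimeNeuro : ∀ n ∈ ListNeuro, n.Output.length = Time + 1

def lenNC (nc : NeuroCircuit) : ℕ := nc.ListNeuro.length + nc.SupplInput

def output_neuron_init (nc : NeuroCircuit) (id : ℕ) : List Bool :=
  match nc.ListNeuro.find? (fun x => x.Feature.Id == id) with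
  | some x => x.Output
  | none => []

def NextNeuroInNC (nc : NeuroCircuit) (inp : ℕ → Bool) : Neuron → Neuron :=
  NextNeuron
    (fun x => if x < nc.ListNeuro.length then (output_neuron_init nc x).headD false else inp x)
    (lenNC nc)

def NextListNeuro (nc : NeuroCircuit) (inp : ℕ → Bool) : List Neuron :=
  nc.ListNeuro.map (NextNeuroInNC nc inp)

def NextStepC (nc : NeuroCircuit) (inp : ℕ → Bool) : NeuroCircuit where
  Time := nc.Time + 1
  ListNeuro := NextListNeuro nc inp
  SupplInput := nc.SupplInput
  IdNeuroDiff := by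
    unfold NextListNeuro
    exact nc.IdNeuroDiff.map _ (fun a b h => h)
  IdInfLen := by
    intro n hn
    unfold NextListNeuro at hn ⊢
    rw [List.mem_map] at hn
    obtain ⟨m, hm, rfl⟩ := hn
    simpa [NextNeuroInNC, NextNeuron] using nc.IdInfLen m hm
  TimeNeuro := by
    intro n hn
    unfold NextListNeuro at hn
    rw [List.mem_map] at hn
    obtain ⟨m, hm, rfl⟩ := hn
    simp [NextNeuroInNC, NextNeuron, nc.TimeNeuro m hm]

def Nstepscircuit (nc : NeuroCircuit) (inp : List (ℕ → Bool)) : NeuroCircuit :=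
  match inp with
  | [] => nc
  | h :: tl => NextStepC (Nstepscircuit nc tl) h

def output_neuron (nc : NeuroCircuit) (inp : List (ℕ → Bool)) (id : ℕ) : List Bool :=
  match (Nstepscircuit nc inp).ListNeuro.find? (fun x => x.Feature.Id == id) with
  | some x => x.Output
  | none => []

def curpot_neuron (nc : NeuroCircuit) (inp : List (ℕ → Bool)) (id : ℕ) : ℚ :=
  match (Nstepscircuit nc inp).ListNeuro.find? (fun x => x.Feature.Id == id) with
  | some x => x.CurPot
  | none => 0

def is_initial_Cir (nc : NeuroCircuit) : Prop :=
  ∀ n ∈ nc.ListNeuro, ∃ nf : NeuronFeature, EquivNeuron n (SetNeuron nf) (lenNC nc)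

def repeat_pattern (l : List Bool) (n : ℕ) : List Bool :=
  if l = [] then []
  else (List.range n).map (fun i => l.getD ((n - 1 - i) % l.length) false)

theorem aux_potential (w : ℕ → ℚ) (inp : ℕ → Bool) (m : ℕ) (len : ℕ)
    (h : ∀ id', m ≠ id' → id' < len → w id' = 0) :
    potential w inp len = if m < len ∧ inp m = true then w m else 0 := by
  induction len with
  | zero => simp [potential]
  | succ k ih =>
    have ih' := ih (fun id' h1 h2 => h id' h1 (by omega))
    rw [potential, ih']
    by_cases hk : m = k
    · subst hk
      simp
    · have h0 := h k hk (by omega)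
      have : (m < k + 1) ↔ m < k := by omega
      simp [h0, this]

theorem aux_find (l : List Neuron)
    (hl : l.Pairwise (fun a b => a.Feature.Id ≠ b.Feature.Id)) (N : Neuron) (hN : N ∈ l) :
    l.find? (fun x => x.Feature.Id == N.Feature.Id) = some N := by
  induction l with
  | nil => simp at hN
  | cons a t ih =>
    rw [List.pairwise_cons] at hl
    rcases List.mem_cons.mp hN with h | h
    · subst h
      simp
    · have hne := hl.1 N h
      rw [List.find?_cons_of_neg (by simpa using hne)]
      exact ih hl.2 h

theorem aux_len (NC : NeuroCircuit) (inp : List (ℕ → Bool)) :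
    (Nstepscircuit NC inp).ListNeuro.length = NC.ListNeuro.length ∧
    lenNC (Nstepscircuit NC inp) = lenNC NC := by
  induction inp with
  | nil => exact ⟨rfl, rfl⟩
  | cons i tl ih =>
    simpa [Nstepscircuit, NextStepC, NextListNeuro, lenNC] using ih

theorem aux_inv (NC : NeuroCircuit) (N : Neuron) (m : ℕ)
    (inp : List (ℕ → Bool))
    (hinit : is_initial_Cir NC)
    (hmem : N ∈ NC.ListNeuro)
    (hm1 : NC.ListNeuro.length ≤ m) (hm2 : m < lenNC NC)
    (hone : One_Input_Or_Less N.Feature m (lenNC NC))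
    (hw : N.Feature.Tau ≤ N.Feature.Weights m) :
    ∃ N' ∈ (Nstepscircuit NC inp).ListNeuro, N'.Feature = N.Feature ∧ 0 ≤ N'.CurPot ∧
      N'.Output = (inp.map (fun f => f m)) ++ [false] := by
  induction inp with
  | nil =>
    obtain ⟨nf, -, h1, h2⟩ := hinit N hmem
    exact ⟨N, hmem, rfl, by rw [h2]; exact le_refl _, by rw [h1]; rfl⟩
  | cons i tl ih =>
    obtain ⟨N', hN', hf, hc, ho⟩ := ih
    obtain ⟨hl1, hl2⟩ := aux_len NC tl
    refine ⟨NextNeuroInNC (Nstepscircuit NC tl) i N', List.mem_map_of_mem hN', hf, ?_⟩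
    have hτ := N.Feature.PosTau
    obtain ⟨hlk0, hlk1⟩ := N.Feature.LeakRange
    have hp := aux_potential N.Feature.Weights
      (fun x => if x < (Nstepscircuit NC tl).ListNeuro.length then
        (output_neuron_init (Nstepscircuit NC tl) x).headD false else i x) m (lenNC NC) hone.2
    have hnm : ¬ m < NC.ListNeuro.length := by omega
    simp only [hl1, hnm, hm2, if_false, true_and] at hp
    have hmul := mul_nonneg hlk0 hc
    have hmul2 := mul_le_mul_of_nonneg_right hlk1 hc
    simp only [NextNeuroInNC, NextNeuron, NextPotential, hl1, hl2, hf, hp, ho, List.map_cons,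
      List.cons_append, List.cons.injEq, and_true]
    cases him : i m
    · by_cases hfire : N.Feature.Tau ≤ N'.CurPot
      · simp [hfire, hτ]
      · simp only [hfire, if_false]
        push Not at hfire
        simp
        constructor <;> linarith
    · by_cases hfire : N.Feature.Tau ≤ N'.CurPot
      · simp [hfire, hw]; linarith
      · simp [hfire]
        constructor <;> linarith

theorem One_Input_NC_delay_Ext (NC : NeuroCircuit) (N : Neuron) (m : ℕ)
    (inp : List (ℕ → Bool))
    (hinit : is_initial_Cir NC)
    (hmem : N ∈ NC.ListNeuro)
    (hm1 : NC.ListNeuro.length ≤ m) (hm2 : m < lenNC NC)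
    (hone : One_Input_Or_Less N.Feature m (lenNC NC))
    (hw : N.Feature.Tau ≤ N.Feature.Weights m) :
    output_neuron NC inp N.Feature.Id =
      (inp.map (fun f => f m)) ++ [false] := by 
  obtain ⟨N', h1, h2, -, h4⟩ := aux_inv NC N m inp hinit hmem hm1 hm2 hone hw
  have h := aux_find _ (Nstepscircuit NC inp).IdNeuroDiff N' h1
  rw [h2] at h
  simp only [output_neuron, h, h4]
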